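/- For every positive integer n, the Turing machine M5 halts when started from the initial configuration ωb (A 1) 1^{n−1} bω if and only if there exists m ≥ 0 with T^m(n) = 1. -/

import Mathlib

namespace Collatz

/-- The 3x+1 function. -/
def T (x : ℕ) : ℕ := if x % 2 = 0 then x / 2 else (3 * x + 1) / 2

/-- The 3x+1 conjecture: iterating `T` from any positive integer
eventually reaches the loop `2 ↦ 1 ↦ 2`. -/
def CollatzConjecture : Prop :=
  ∀ x : ℕ, 0 < x → ∃ k : ℕ, T^[k] x = 2 ∧ T^[k + 1] x = 1

inductive St | A | B | C | D | H
  deriving DecidableEq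

inductive Sym | sb | s1 | sx | sa | sz | sr
  deriving DecidableEq

open St Sym

/-- Transition table of the Turing machine `M5`
(`true` = move right, `false` = move left); `H` is the halting state. -/
def delta : St → Sym → Option (Sym × Bool × St)
  | A, sb => some (sb, true, A)
  | A, s1 => some (sx, true, D)
  | A, sx => some (s1, false, A)
  | A, sa => some (s1, false, A)
  | A, sz => some (sr, true, B)
  | A, sr => none
  | B, sb => some (s1, false, B)
  | B, s1 => some (sa, true, C)
  | B, sx => some (s1, false, B)
  | B, sa => some (s1, false, A)
  | B, sz => some (sx, true, B)
  | B, sr => some (sb, true, A)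
  | C, sb => some (sz, false, C)
  | C, s1 => some (sx, true, C)
  | C, sx => some (s1, false, C)
  | C, sa => some (sa, true, A)
  | C, sz => some (sr, true, C)
  | C, sr => some (sz, false, C)
  | D, sb => some (sb, false, H)
  | D, s1 => some (sa, true, C)
  | D, sz => some (sx, true, B)
  | D, _  => none
  | H, _  => none

structure Cfg where
  state : St
  head : ℤ
  tape : ℤ → Sym

/-- One step of the machine; `none` when the transition is undefined
(in particular in the halting state, which has no transitions).
In `delta`, the `Bool` component is the direction: `true` = right, `false` = left. -/
def step (c : Cfg) : Option Cfg :=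
  (delta c.state (c.tape c.head)).map fun t =>
    ⟨t.2.2, c.head + (if t.2.1 then 1 else -1), Function.update c.tape c.head t.1⟩

/-- `steps n c` is the configuration after `n` steps from `c`
(`none` if the machine has halted meanwhile). -/
def steps : ℕ → Cfg → Option Cfg
  | 0, c => some c
  | n + 1, c => (step c).bind (steps n)

/-- The tape holding the word `w` at positions `0, …, w.length - 1`,
and the blank symbol everywhere else. -/
def tapeOf (w : List Sym) : ℤ → Sym :=
  fun i => if 0 ≤ i then w.getD i.toNat sb else sb

/-- `c` is the configuration `ωb u (q s) v bω`, where `w = u ++ s :: v` and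
`pos = u.length` (i.e. the tape holds exactly the word `w` surrounded by blanks,
the machine is in state `q`, and the head scans the symbol of `w` at index `pos`). -/
def IsConfig (c : Cfg) (q : St) (w : List Sym) (pos : ℕ) : Prop :=
  c.state = q ∧ ∃ d : ℤ, c.head = d + pos ∧ c.tape = fun i => tapeOf w (i - d)

/-- The machine eventually reaches the configuration `ωb u (q s) v bω`. -/
def Reaches (c : Cfg) (q : St) (w : List Sym) (pos : ℕ) : Prop :=
  ∃ t : ℕ, ∃ c' : Cfg, steps t c = some c' ∧ IsConfig c' q w pos

/-- The machine halts when started from configuration `c`. -/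
def Halts (c : Cfg) : Prop := ∃ n : ℕ, steps n c = none

/-- Initial configuration: word `w` on the tape, head on its leftmost symbol, state `A`. -/
def initCfg (w : List Sym) : Cfg := ⟨St.A, 0, tapeOf w⟩

/-- Directed configuration: the tape is cut just before cell `p`; the head is just right of the
cut when `d = true` and just left of it when `d = false`. -/
def mk (p : ℤ) (q : St) (d : Bool) (L R : List Sym) : Cfg :=
  ⟨q, if d then p else p - 1,
    fun i => if p ≤ i then R.getD (i - p).toNat sb else L.getD (p - 1 - i).toNat sb⟩

/-- `Rn m …`: the second configuration is reached from the first in at least `m` steps. -/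
def Rn (m : ℕ) (q : St) (d : Bool) (L R : List Sym) (q' : St) (d' : Bool) (L' R' : List Sym) :
    Prop :=
  ∀ p : ℤ, ∃ p' : ℤ, ∃ t : ℕ, m ≤ t ∧ steps t (mk p q d L R) = some (mk p' q' d' L' R')

lemma steps_add (s t : ℕ) (c : Cfg) : steps (s + t) c = (steps s c).bind (steps t) := by
  induction s generalizing c with
  | zero => simp [steps]
  | succ s ih =>
    rw [show s + 1 + t = s + t + 1 by ring]
    simp only [steps]
    cases h : step c with
    | none => simp
    | some c' => simp [ih]

lemma Rn.refl {q d L R} : Rn 0 q d L R q d L R := fun p => ⟨p, 0, le_refl _, rfl⟩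

lemma Rn.trans {m m' q d L R q' d' L' R' q'' d'' L'' R''} (h : Rn m q d L R q' d' L' R')
    (h' : Rn m' q' d' L' R' q'' d'' L'' R'') : Rn m q d L R q'' d'' L'' R'' := by
  intro p
  obtain ⟨p1, t1, h1, e1⟩ := h p
  obtain ⟨p2, t2, h2, e2⟩ := h' p1
  exact ⟨p2, t1 + t2, by omega, by rw [steps_add, e1]; simpa using e2⟩

lemma Rn.weak {m q d L R q' d' L' R'} (h : Rn m q d L R q' d' L' R') :
    Rn 0 q d L R q' d' L' R' := by
  intro p
  obtain ⟨p1, t1, h1, e1⟩ := h p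
  exact ⟨p1, t1, by omega, e1⟩

lemma getD_cons_pos (s : Sym) (L : List Sym) (n : ℕ) (h : 0 < n) :
    (s :: L).getD n sb = L.getD (n - 1) sb := by
  obtain ⟨k, rfl⟩ : ∃ k, n = k + 1 := ⟨n - 1, by omega⟩
  simp

lemma one_step {p p' : ℤ} {q d L R s w m q' L' R'} (hs : (mk p q d L R).tape (mk p q d L R).head = s)
    (hd : delta q s = some (w, m, q'))
    (hh : (mk p q d L R).head + (if m then 1 else -1) = (mk p' q' m L' R').head)
    (ht : Function.update (mk p q d L R).tape (mk p q d L R).head w = (mk p' q' m L' R').tape) :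
    steps 1 (mk p q d L R) = some (mk p' q' m L' R') := by
  have hq : (mk p q d L R).state = q := rfl
  simp only [steps, step, hs, hq, hd, Option.map_some, Option.bind_some, hh, ht]
  rfl

lemma step_tt {q L R s w q'} (h : delta q s = some (w, true, q')) :
    Rn 1 q true L (s :: R) q' true (w :: L) R := by
  intro p
  refine ⟨p + 1, 1, le_refl _, one_step (s := s) (by simp [mk]) h (by simp [mk]) ?_⟩
  funext i
  simp only [mk, Function.update_apply, if_true]
  rcases lt_trichotomy i p with hi | hi | hi
  · rw [if_neg (by omega), if_neg (by omega), if_neg (by omega), getD_cons_pos _ _ _ (by omega)]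
    congr 1; omega
  · subst hi; simp
  · rw [if_neg (by omega), if_pos (by omega), if_pos (by omega), getD_cons_pos _ _ _ (by omega)]
    congr 1; omega

lemma step_tf {q L R s w q'} (h : delta q s = some (w, false, q')) :
    Rn 1 q true L (s :: R) q' false L (w :: R) := by
  intro p
  refine ⟨p, 1, le_refl _, one_step (s := s) (by simp [mk]) h (by simp [mk]; ring) ?_⟩
  funext i
  simp only [mk, Function.update_apply, if_true]
  rcases lt_trichotomy i p with hi | hi | hi
  · rw [if_neg (by omega), if_neg (by omega), if_neg (by omega)]
  · subst hi; simp
  · rw [if_neg (by omega), if_pos (by omega), if_pos (by omega), getD_cons_pos _ _ _ (by omega),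
      getD_cons_pos _ _ _ (by omega)]

lemma step_ft {q L R s w q'} (h : delta q s = some (w, true, q')) :
    Rn 1 q false (s :: L) R q' true (w :: L) R := by
  intro p
  refine ⟨p, 1, le_refl _, one_step (s := s) (by simp [mk]) h (by simp [mk]) ?_⟩
  funext i
  simp only [mk, Function.update_apply]
  rcases lt_trichotomy i (p - 1) with hi | hi | hi
  · rw [if_neg (by simp; omega), if_neg (by omega), if_neg (by omega),
      getD_cons_pos _ _ _ (by omega), getD_cons_pos _ _ _ (by omega)]
  · subst hi; simp
  · rw [if_neg (by simp; omega), if_pos (by omega), if_pos (by omega)]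

lemma step_ff {q L R s w q'} (h : delta q s = some (w, false, q')) :
    Rn 1 q false (s :: L) R q' false L (w :: R) := by
  intro p
  refine ⟨p - 1, 1, le_refl _, one_step (s := s) (by simp [mk]) h (by simp [mk]; ring) ?_⟩
  funext i
  simp only [mk, Function.update_apply]
  rcases lt_trichotomy i (p - 1) with hi | hi | hi
  · rw [if_neg (by simp; omega), if_neg (by omega), if_neg (by omega),
      getD_cons_pos _ _ _ (by omega)]
    congr 1; omega
  · subst hi; simp
  · rw [if_neg (by simp; omega), if_pos (by omega), if_pos (by omega),
      getD_cons_pos _ _ _ (by omega)]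
    congr 1; omega

lemma getD_single (n : ℕ) : ([sb] : List Sym).getD n sb = ([] : List Sym).getD n sb := by
  cases n <;> simp

lemma mk_blankR (p q d L) : mk p q d L [] = mk p q d L [sb] := by
  simp only [mk, getD_single]

lemma mk_blankL (p q d R) : mk p q d [] R = mk p q d [sb] R := by
  simp only [mk, getD_single]

lemma step_bf {q L w q'} (h : delta q sb = some (w, false, q')) :
    Rn 1 q true L [] q' false L [w] := by
  intro p
  rw [mk_blankR]
  exact step_tf h p

lemma rep_snoc (k : ℕ) (s : Sym) (R : List Sym) :
    List.replicate k s ++ s :: R = List.replicate (k + 1) s ++ R := by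
  induction k with
  | zero => rfl
  | succ k ih => rw [List.replicate_succ, List.cons_append, ih]; rfl

lemma sweepR {q s w} (h : delta q s = some (w, true, q)) (k : ℕ) (L R : List Sym) :
    Rn 0 q true L (List.replicate k s ++ R) q true (List.replicate k w ++ L) R := by
  induction k generalizing L with
  | zero => exact Rn.refl
  | succ k ih =>
    have := (step_tt (L := L) (R := List.replicate k s ++ R) h).weak.trans (ih _)
    rwa [rep_snoc] at this

lemma sweepL {q s w} (h : delta q s = some (w, false, q)) (k : ℕ) (L R : List Sym) :
    Rn 0 q false (List.replicate k s ++ L) R q false L (List.replicate k w ++ R) := by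
  induction k generalizing R with
  | zero => exact Rn.refl
  | succ k ih =>
    have := (step_ff (R := R) (L := List.replicate k s ++ L) h).weak.trans (ih _)
    rwa [rep_snoc] at this

/-- `(xa)^j` to the right of the left part `L` (read from the cut). -/
def AX : ℕ → List Sym → List Sym
  | 0, L => L
  | j + 1, L => sa :: sx :: AX j L

lemma loop1 (j k : ℕ) (L : List Sym) :
    Rn 1 A true (AX j L) (List.replicate (k + 2) s1 ++ List.replicate j sz)
      A true (AX (j + 1) L) (List.replicate k s1 ++ List.replicate (j + 1) sz) := by
  have e1 : Rn 1 A true (AX j L) (s1 :: s1 :: (List.replicate k s1 ++ List.replicate j sz))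
    D true (sx :: AX j L) (s1 :: (List.replicate k s1 ++ List.replicate j sz)) := step_tt rfl
  have e2 : Rn 1 D true (sx :: AX j L) (s1 :: (List.replicate k s1 ++ List.replicate j sz))
    C true (AX (j + 1) L) (List.replicate k s1 ++ List.replicate j sz) := step_tt rfl
  have e3 := sweepR (q := C) (s := s1) (w := sx) rfl k (AX (j + 1) L) (List.replicate j sz)
  have e4 := sweepR (q := C) (s := sz) (w := sr) rfl j (List.replicate k sx ++ AX (j + 1) L) []
  rw [List.append_nil] at e4
  have e5 := step_bf (q := C) (w := sz) (q' := C)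
    (L := List.replicate j sr ++ (List.replicate k sx ++ AX (j + 1) L)) rfl
  have e6 := sweepL (q := C) (s := sr) (w := sz) rfl j (List.replicate k sx ++ AX (j + 1) L) [sz]
  rw [rep_snoc, List.append_nil] at e6
  have e7 := sweepL (q := C) (s := sx) (w := s1) rfl k (AX (j + 1) L) (List.replicate (j + 1) sz)
  have e8 : Rn 1 C false (AX (j + 1) L) (List.replicate k s1 ++ List.replicate (j + 1) sz)
    A true (AX (j + 1) L) (List.replicate k s1 ++ List.replicate (j + 1) sz) := step_ft rfl
  exact e1.trans (e2.trans (e3.trans (e4.trans (e5.trans (e6.trans (e7.trans e8))))))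

lemma loop (i j k : ℕ) (L : List Sym) :
    Rn 0 A true (AX j L) (List.replicate (k + 2 * i) s1 ++ List.replicate j sz)
      A true (AX (j + i) L) (List.replicate k s1 ++ List.replicate (j + i) sz) := by
  induction i generalizing j with
  | zero => exact Rn.refl
  | succ i ih =>
    have := (loop1 j (k + 2 * i) L).weak.trans (ih (j + 1))
    rwa [show j + 1 + i = j + (i + 1) by ring] at this

lemma loop' (j k : ℕ) (L : List Sym) :
    Rn 1 A true L (List.replicate (k + 2 * (j + 1)) s1)
      A true (AX (j + 1) L) (List.replicate k s1 ++ List.replicate (j + 1) sz) := by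
  have h1 := loop1 0 (k + 2 * j) L
  have h2 := loop j 1 k L
  rw [zero_add] at h1
  rw [add_comm 1 j] at h2
  have := h1.trans h2
  rw [show k + 2 * j + 2 = k + 2 * (j + 1) by ring] at this
  simpa [AX] using this

lemma even_case (j : ℕ) (L : List Sym) :
    ∃ L', Rn 1 A true L (List.replicate (2 * (j + 1)) s1)
      A true (sb :: L') (List.replicate (j + 1) s1) := by
  refine ⟨AX (j + 1) L, ?_⟩
  have e0 := loop' j 0 L
  rw [zero_add] at e0
  have e1 : Rn 1 A true (AX (j + 1) L) (List.replicate 0 s1 ++ List.replicate (j + 1) sz)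
    B true (sr :: AX (j + 1) L) (List.replicate j sz) := step_tt rfl
  have e2 := sweepR (q := B) (s := sz) (w := sx) rfl j (sr :: AX (j + 1) L) []
  rw [List.append_nil] at e2
  have e3 := step_bf (q := B) (w := s1) (q' := B)
    (L := List.replicate j sx ++ (sr :: AX (j + 1) L)) rfl
  have e4 := sweepL (q := B) (s := sx) (w := s1) rfl j (sr :: AX (j + 1) L) [s1]
  rw [rep_snoc, List.append_nil] at e4
  have e5 : Rn 1 B false (sr :: AX (j + 1) L) (List.replicate (j + 1) s1)
    A true (sb :: AX (j + 1) L) (List.replicate (j + 1) s1) := step_ft rfl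
  exact e0.trans (e1.trans (e2.trans (e3.trans (e4.trans e5))))

lemma wipe_left (j k : ℕ) (L : List Sym) :
    Rn 0 A false (AX j L) (List.replicate k s1) A false L (List.replicate (k + 2 * j) s1) := by
  induction j generalizing k with
  | zero => exact Rn.refl
  | succ j ih =>
    have e1 : Rn 1 A false (AX (j + 1) L) (List.replicate k s1)
      A false (sx :: AX j L) (List.replicate (k + 1) s1) := step_ff rfl
    have e2 : Rn 1 A false (sx :: AX j L) (List.replicate (k + 1) s1)
      A false (AX j L) (List.replicate (k + 2) s1) := step_ff rfl
    have := e1.weak.trans (e2.trans (ih (k + 2)))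
    rwa [show k + 2 + 2 * j = k + 2 * (j + 1) by ring] at this

lemma odd_case (j : ℕ) (L : List Sym) :
    Rn 1 A true (sb :: L) (List.replicate (1 + 2 * (j + 1)) s1)
      A true (sb :: L) (List.replicate (3 * j + 5) s1) := by
  set M := sb :: L with hM
  have e0 := loop' j 1 M
  have e1 : Rn 1 A true (AX (j + 1) M) (List.replicate 1 s1 ++ List.replicate (j + 1) sz)
    D true (sx :: AX (j + 1) M) (List.replicate (j + 1) sz) := step_tt rfl
  have e1' : Rn 1 D true (sx :: AX (j + 1) M) (List.replicate (j + 1) sz)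
    B true (sx :: sx :: AX (j + 1) M) (List.replicate j sz) := step_tt rfl
  have e2 := sweepR (q := B) (s := sz) (w := sx) rfl j (sx :: sx :: AX (j + 1) M) []
  rw [List.append_nil, rep_snoc, rep_snoc] at e2
  have e3 := step_bf (q := B) (w := s1) (q' := B)
    (L := List.replicate (j + 1 + 1) sx ++ AX (j + 1) M) rfl
  have e4 := sweepL (q := B) (s := sx) (w := s1) rfl (j + 1 + 1) (AX (j + 1) M) [s1]
  rw [rep_snoc, List.append_nil] at e4
  have e5 : Rn 1 B false (AX (j + 1) M) (List.replicate (j + 1 + 1 + 1) s1)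
    A false (sx :: AX j M) (List.replicate (j + 4) s1) := step_ff rfl
  have e6 : Rn 1 A false (sx :: AX j M) (List.replicate (j + 4) s1)
    A false (AX j M) (List.replicate (j + 5) s1) := step_ff rfl
  have e7 := wipe_left j (j + 5) M
  rw [show j + 5 + 2 * j = 3 * j + 5 by ring] at e7
  have e8 : Rn 1 A false M (List.replicate (3 * j + 5) s1)
    A true M (List.replicate (3 * j + 5) s1) := step_ft rfl
  exact e0.trans (e1.trans (e1'.trans (e2.trans (e3.trans (e4.trans (e5.trans
    (e6.trans (e7.trans e8))))))))

lemma big_step (n : ℕ) (hn : 2 ≤ n) (L : List Sym) :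
    ∃ L', Rn 1 A true (sb :: L) (List.replicate n s1)
      A true (sb :: L') (List.replicate (T n) s1) := by
  rcases Nat.even_or_odd' n with ⟨k, rfl | rfl⟩
  · obtain ⟨j, rfl⟩ : ∃ j, k = j + 1 := ⟨k - 1, by omega⟩
    have : T (2 * (j + 1)) = j + 1 := by unfold T; split_ifs <;> omega
    rw [this]
    exact even_case j _
  · obtain ⟨j, rfl⟩ : ∃ j, k = j + 1 := ⟨k - 1, by omega⟩
    have : T (2 * (j + 1) + 1) = 3 * j + 5 := by unfold T; split_ifs <;> omega
    rw [this, add_comm (2 * (j + 1)) 1]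
    exact ⟨L, odd_case j L⟩

lemma T_pos (n : ℕ) (hn : 0 < n) : 0 < T n := by unfold T; split_ifs <;> omega

lemma halts_one (p : ℤ) (L : List Sym) : Halts (mk p A true L (List.replicate 1 s1)) := by
  have e1 : Rn 1 A true L (List.replicate 1 s1) D true (sx :: L) [] := step_tt rfl
  have e2 : Rn 1 D true (sx :: L) [] H false (sx :: L) [sb] := step_bf rfl
  obtain ⟨p', t, -, h⟩ := e1.trans e2 p
  refine ⟨t + 1, ?_⟩
  rw [steps_add, h]
  simp [steps, step, mk, delta]

lemma halts_of_iter (m : ℕ) : ∀ (n : ℕ) (p : ℤ) (L : List Sym), 0 < n → T^[m] n = 1 →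
    Halts (mk p A true (sb :: L) (List.replicate n s1)) := by
  induction m with
  | zero =>
    intro n p L _ h
    simp only [Function.iterate_zero, id] at h
    subst h
    exact halts_one p _
  | succ m ih =>
    intro n p L hn h
    rcases Nat.lt_or_ge n 2 with h2 | h2
    · obtain rfl : n = 1 := by omega
      exact halts_one p _
    · obtain ⟨L', hr⟩ := big_step n h2 L
      obtain ⟨p', t, -, ht⟩ := hr p
      obtain ⟨k, hk⟩ := ih (T n) p' L' (T_pos n hn) (by simpa [Function.iterate_succ] using h)
      exact ⟨t + k, by rw [steps_add, ht]; simpa using hk⟩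

lemma iter_of_halts (k : ℕ) : ∀ (n : ℕ) (p : ℤ) (L : List Sym), 0 < n →
    steps k (mk p A true (sb :: L) (List.replicate n s1)) = none → ∃ m, T^[m] n = 1 := by
  induction k using Nat.strong_induction_on with
  | _ k ih =>
    intro n p L hn h
    rcases Nat.lt_or_ge n 2 with h2 | h2
    · exact ⟨0, by simp; omega⟩
    · obtain ⟨L', hr⟩ := big_step n h2 L
      obtain ⟨p', t, h1, ht⟩ := hr p
      rcases Nat.lt_or_ge k t with hkt | hkt
      · obtain ⟨s, rfl⟩ := Nat.exists_eq_add_of_lt hkt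
        rw [add_assoc, steps_add, h] at ht
        simp at ht
      · obtain ⟨s, rfl⟩ := Nat.exists_eq_add_of_le hkt
        rw [steps_add, ht, Option.bind_some] at h
        obtain ⟨m, hm⟩ := ih s (by omega) (T n) p' L' (T_pos n hn) h
        exact ⟨m + 1, by simpa [Function.iterate_succ] using hm⟩

lemma init_eq (w : List Sym) : initCfg w = mk 0 A true [sb] w := by
  rw [← mk_blankL]
  simp only [initCfg, mk, if_true, Cfg.mk.injEq, true_and]
  funext i
  simp [tapeOf]

/-- For every positive integer `n`, the machine `M5` halts when started from
`ωb (A 1) 1^{n-1} bω` iff some iterate of `T` at `n` is `1`. -/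
theorem M5_halts_iff_iterate_one (n : ℕ) (hn : 0 < n) :
    Halts (initCfg (List.replicate n s1)) ↔ (∃ m : ℕ, T^[m] n = 1) := by
  rw [init_eq]
  constructor
  · rintro ⟨k, hk⟩
    exact iter_of_halts k n 0 [] hn hk
  · rintro ⟨m, hm⟩
    exact halts_of_iter m n 0 [] hn hm

end Collatz
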